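/- arXiv:2309.12409 — 3 statements merged into one kernel-verified Lean document; each statement's English description precedes it below -/
import Mathlib

section
/- Let u be a classical solution of the nonlocal Allen–Cahn equation ∂ₜu = Δu − ε⁻²W′(u) + λ_ε(t)√(2W(u)) on ℝ^d × [0,T], with λ_ε(t) := −(∫_{ℝ^d} (Δu − ε⁻²W′(u))√(2W(u)) dx)/(∫_{ℝ^d} 2W(u) dx). Let ξ ∈ C¹(ℝ^d × [0,T]; ℝ^d) be bounded with bounded derivatives, and let λ : [0,T] → ℝ be any function. Then the relative energy E(t) := ∫_{ℝ^d} ( (ε/2)|∇u|² + ε⁻¹W(u) ) dx + ∫_{ℝ^d} ξ·∇ψ dx satisfies, for every t ∈ (0,T), d/dt E(t) = −∫_{ℝ^d} ε (∂ₜu)² dx − ∫_{ℝ^d} (∇·ξ − λ(t)) √(2W(u)) ∂ₜu dx + ∫_{ℝ^d} ∂ₜξ·∇ψ dx, where ψ(x,t) := φ(u(x,t)) with φ(r) := ∫₀^r √(2W(z)) dz (so ∇ψ = √(2W(u))∇u), and all spatial integrals are taken at the fixed time t. -/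
open MeasureTheory
open scoped RealInnerProductSpace

/-- The divergence of a vector field on `ℝ^d`. -/
noncomputable def divg {d : ℕ} (F : EuclideanSpace ℝ (Fin d) → EuclideanSpace ℝ (Fin d))
    (x : EuclideanSpace ℝ (Fin d)) : ℝ :=
  ∑ i : Fin d, ⟪fderiv ℝ F x (EuclideanSpace.single i 1), EuclideanSpace.single i 1⟫

/-- The Laplacian `Δf = ∇ · ∇f` on `ℝ^d`. -/
noncomputable def lap {d : ℕ} (f : EuclideanSpace ℝ (Fin d) → ℝ)
    (x : EuclideanSpace ℝ (Fin d)) : ℝ :=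
  divg (gradient f) x

open scoped Topology NNReal

section Parametric

variable {X V : Type*} [TopologicalSpace X] [NormedAddCommGroup V] [NormedSpace ℝ V]
  {T : ℝ} {f f' : ℝ → X → V} {S : Set X}

/-- On a compact set of parameters, a family of curves with jointly continuous velocity is
uniformly Lipschitz in time. -/
theorem exists_lipschitz_of_continuousOn_deriv (hS : IsCompact S)
    (hf : ∀ x, ∀ t ∈ Set.Icc (0:ℝ) T,
      HasDerivWithinAt (fun s => f s x) (f' t x) (Set.Icc 0 T) t)
    (hf' : ContinuousOn (fun p : ℝ × X => f' p.1 p.2) (Set.Icc 0 T ×ˢ Set.univ)) :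
    ∃ C : ℝ≥0, ∀ x ∈ S, ∀ s ∈ Set.Icc (0:ℝ) T, ∀ t ∈ Set.Icc (0:ℝ) T,
      ‖f s x - f t x‖ ≤ C * ‖s - t‖ := by
  obtain ⟨C, hC⟩ := (isCompact_Icc.prod hS).exists_bound_of_continuousOn
    (hf'.mono (Set.prod_mono subset_rfl (Set.subset_univ S)))
  refine ⟨C.toNNReal, fun x hx s hs t ht => ?_⟩
  exact Convex.norm_image_sub_le_of_norm_hasDerivWithin_le (hf x)
    (fun r hr => (hC (r, x) ⟨hr, hx⟩).trans (Real.le_coe_toNNReal C)) (convex_Icc 0 T) ht hs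

/-- A function continuous in space with jointly continuous time derivative is jointly continuous. -/
theorem continuousOn_prod_of_continuousOn_deriv [WeaklyLocallyCompactSpace X]
    (hf : ∀ x, ∀ t ∈ Set.Icc (0:ℝ) T,
      HasDerivWithinAt (fun s => f s x) (f' t x) (Set.Icc 0 T) t)
    (hf' : ContinuousOn (fun p : ℝ × X => f' p.1 p.2) (Set.Icc 0 T ×ˢ Set.univ))
    (hfc : ∀ t ∈ Set.Icc (0:ℝ) T, Continuous (f t)) :
    ContinuousOn (fun p : ℝ × X => f p.1 p.2) (Set.Icc 0 T ×ˢ Set.univ) := by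
  rintro ⟨t, x⟩ ⟨ht, -⟩
  obtain ⟨S, hS, hSx⟩ := exists_compact_mem_nhds x
  obtain ⟨C, hC⟩ := exists_lipschitz_of_continuousOn_deriv hS hf hf'
  have hcont : ContinuousOn (fun p : ℝ × X => f p.1 p.2) (Set.Icc 0 T ×ˢ S) :=
    continuousOn_prod_of_continuousOn_lipschitzOnWith (fun p : ℝ × X => f p.1 p.2) C
      (fun s hs => (hfc s hs).continuousOn)
      (fun y hy => LipschitzOnWith.of_dist_le_mul fun s hs r hr => by
        simpa [dist_eq_norm] using hC y hy s hs r hr)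
  refine (hcont (t, x) ⟨ht, mem_of_mem_nhds hSx⟩).mono_of_mem_nhdsWithin ?_
  rw [nhdsWithin_prod_eq, nhdsWithin_univ]
  exact Filter.prod_mem_prod self_mem_nhdsWithin hSx

end Parametric

section Integral

variable {X : Type*} [TopologicalSpace X] [R1Space X] [MeasurableSpace X] [OpensMeasurableSpace X]
  {μ : Measure X} [IsFiniteMeasureOnCompacts μ]

theorem Continuous.integrable_of_eq_zero_off_compact {f : X → ℝ} (hf : Continuous f) {K : Set X}
    (hK : IsCompact K) (h0 : ∀ x ∉ K, f x = 0) : Integrable f μ :=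
  hf.integrable_of_hasCompactSupport (HasCompactSupport.intro hK h0)

/-- Differentiation under the integral sign for integrands supported in a common compact set and
Lipschitz at the base point. -/
theorem hasDerivAt_integral_of_compact_of_lip {K : Set X} (hK : IsCompact K)
    {S : Set ℝ} {t : ℝ} (hS : S ∈ 𝓝 t) {F : ℝ → X → ℝ} {F' : X → ℝ} {C : ℝ≥0}
    (hF : ∀ s ∈ S, Continuous (F s)) (hF0 : ∀ s ∈ S, ∀ x ∉ K, F s x = 0)
    (hF' : Continuous F')
    (hlip : ∀ x ∈ K, ∀ s ∈ S, ‖F s x - F t x‖ ≤ C * ‖s - t‖)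
    (hderiv : ∀ x, HasDerivAt (fun s => F s x) (F' x) t) :
    HasDerivAt (fun s => ∫ x, F s x ∂μ) (∫ x, F' x ∂μ) t := by
  have htS : t ∈ S := mem_of_mem_nhds hS
  let L : ℝ →L[ℝ] ℝ →L[ℝ] ℝ := ContinuousLinearMap.smulRightL ℝ ℝ ℝ 1
  have hderiv0 : ∀ x ∉ K, F' x = 0 := fun x hx => by
    refine (hderiv x).unique ((hasDerivAt_const t (0:ℝ)).congr_of_eventuallyEq ?_)
    filter_upwards [hS] with s hs using hF0 s hs x hx
  have hint : Integrable F' μ := hF'.integrable_of_eq_zero_off_compact hK hderiv0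
  have hbound : Integrable ((closure K).indicator fun _ => (C : ℝ)) μ :=
    (integrable_indicator_iff isClosed_closure.measurableSet).2
      (integrableOn_const hK.closure.measure_lt_top.ne)
  have key := (hasFDerivAt_integral_of_dominated_loc_of_lip' (μ := μ) (𝕜 := ℝ) (F := F) (x₀ := t)
    (F' := fun x => L (F' x)) hS (fun s hs => ((hF s hs).integrable_of_eq_zero_off_compact hK
      (hF0 s hs)).aestronglyMeasurable)
    ((hF t htS).integrable_of_eq_zero_off_compact hK (hF0 t htS))
    (L.continuous.comp_aestronglyMeasurable hint.aestronglyMeasurable)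
    (Filter.Eventually.of_forall fun x s hs => ?_) hbound
    (Filter.Eventually.of_forall fun x => (hderiv x).hasFDerivAt)).2
  · rw [L.integral_comp_comm hint] at key
    simpa [L] using key.hasDerivAt
  · by_cases hx : x ∈ K
    · simpa [Set.indicator_of_mem (subset_closure hx)] using hlip x hx s hs
    · rw [hF0 s hs x hx, hF0 t htS x hx, sub_zero, norm_zero]
      by_cases hxc : x ∈ closure K
      · rw [Set.indicator_of_mem hxc]
        positivity
      · simp [hxc]

/-- Differentiation under the integral sign for integrands supported in a common compact set whose
time derivative is jointly continuous. -/
theorem hasDerivAt_integral_of_compact_of_continuousOn_deriv {K : Set X} (hK : IsCompact K)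
    {T t : ℝ} (ht : t ∈ Set.Ioo 0 T) {F F' : ℝ → X → ℝ}
    (hF : ∀ s ∈ Set.Icc 0 T, Continuous (F s)) (hF0 : ∀ s ∈ Set.Icc 0 T, ∀ x ∉ K, F s x = 0)
    (hderiv : ∀ x, ∀ t ∈ Set.Icc (0:ℝ) T,
      HasDerivWithinAt (fun s => F s x) (F' t x) (Set.Icc 0 T) t)
    (hF' : ContinuousOn (fun p : ℝ × X => F' p.1 p.2) (Set.Icc 0 T ×ˢ Set.univ)) :
    HasDerivAt (fun s => ∫ x, F s x ∂μ) (∫ x, F' t x ∂μ) t := by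
  have htI := Set.Ioo_subset_Icc_self ht
  have hnhds := Icc_mem_nhds ht.1 ht.2
  obtain ⟨C, hC⟩ := exists_lipschitz_of_continuousOn_deriv hK hderiv hF'
  exact hasDerivAt_integral_of_compact_of_lip hK hnhds hF hF0
    (hF'.comp_continuous (f := fun x => (t, x)) (by fun_prop) fun x => ⟨htI, trivial⟩)
    (fun x hx s hs => hC x hx s hs t htI) fun x => (hderiv x t htI).hasDerivAt hnhds

end Integral

/-- A vanishing differentiable factor makes a product with a merely continuous factor
differentiable. -/
theorem HasDerivAt.inner_of_eq_zero {V : Type*} [NormedAddCommGroup V] [InnerProductSpace ℝ V]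
    {f g : ℝ → V} {f' : V} {t : ℝ} (hf : HasDerivAt f f' t) (hg : ContinuousAt g t)
    (h0 : f t = 0) : HasDerivAt (fun s => ⟪f s, g s⟫) ⟪f', g t⟫ t := by
  rw [hasDerivAt_iff_tendsto_slope] at hf ⊢
  refine (hf.inner (hg.tendsto.mono_left nhdsWithin_le_nhds)).congr fun s => ?_
  simp [slope, h0, real_inner_smul_left]

section Gradient

variable {V : Type*} [NormedAddCommGroup V] [InnerProductSpace ℝ V] [CompleteSpace V]

theorem ContDiff.gradient_right {f : V → ℝ} {m n : WithTop ℕ∞} (hf : ContDiff ℝ n f)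
    (hmn : m + 1 ≤ n) : ContDiff ℝ m (gradient f) :=
  (InnerProductSpace.toDual ℝ V).symm.toContinuousLinearEquiv.contDiff.comp
    (hf.fderiv_right hmn)

theorem gradient_eq_zero_off_closed {f : V → ℝ} {K : Set V} (hK : IsClosed K)
    (h0 : ∀ x ∉ K, f x = 0) {x : V} (hx : x ∉ K) : gradient f x = 0 := by
  have : f =ᶠ[𝓝 x] fun _ => (0:ℝ) := by
    filter_upwards [hK.isOpen_compl.mem_nhds hx] with y hy using h0 y hy
  rw [this.gradient_eq, gradient_fun_const]

theorem gradient_comp {φ : ℝ → ℝ} {φ' : ℝ} {f : V → ℝ} {x : V} (hφ : HasDerivAt φ φ' (f x))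
    (hf : DifferentiableAt ℝ f x) : gradient (fun y => φ (f y)) x = φ' • gradient f x := by
  have h : fderiv ℝ (fun y => φ (f y)) x = φ' • fderiv ℝ f x :=
    (hφ.comp_hasFDerivAt x hf.hasFDerivAt).fderiv
  simp [gradient, h]

end Gradient

section Divergence

variable {d : ℕ} {F : EuclideanSpace ℝ (Fin d) → EuclideanSpace ℝ (Fin d)}
  {g : EuclideanSpace ℝ (Fin d) → ℝ}

theorem ContDiff.continuous_divg (hF : ContDiff ℝ 1 F) : Continuous (divg F) :=
  continuous_finsetSum _ fun _ _ =>
    ((hF.continuous_fderiv one_ne_zero).clm_apply continuous_const).inner continuous_const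

/-- The divergence theorem for a `C¹` field against a compactly supported `C¹` function. -/
theorem integral_inner_gradient_eq_neg_integral_divg_mul (hF : ContDiff ℝ 1 F)
    (hg : ContDiff ℝ 1 g) (hgc : HasCompactSupport g) :
    ∫ x, ⟪F x, gradient g x⟫ = -∫ x, divg F x * g x := by
  have hFi (i : Fin d) : ContDiff ℝ 1 fun x => F x i := by fun_prop
  have hfd (i : Fin d) (x) : fderiv ℝ (fun x => F x i) x (EuclideanSpace.single i 1) =
      ⟪fderiv ℝ F x (EuclideanSpace.single i 1), EuclideanSpace.single i 1⟫ := by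
    have h := (EuclideanSpace.proj (𝕜 := ℝ) i).hasFDerivAt.comp x
      (hF.differentiable one_ne_zero x).hasFDerivAt
    rw [show (fun x => F x i) = (EuclideanSpace.proj (𝕜 := ℝ) i) ∘ F from rfl, h.fderiv]
    simp [EuclideanSpace.inner_single_right]
  have hl (x) : ⟪F x, gradient g x⟫ =
      ∑ i, F x i * fderiv ℝ g x (EuclideanSpace.single i 1) := by
    simp_rw [← inner_gradient_left, EuclideanSpace.inner_single_right, PiLp.inner_apply]
    simp [mul_comm]
  have h1 (i : Fin d) : Integrable fun x =>
      F x i * fderiv ℝ g x (EuclideanSpace.single i 1) :=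
    ((hFi i).continuous.mul ((hg.continuous_fderiv one_ne_zero).clm_apply
      continuous_const)).integrable_of_hasCompactSupport (hgc.fderiv_apply ℝ _).mul_left
  have h2 (i : Fin d) : Integrable fun x =>
      fderiv ℝ (fun x => F x i) x (EuclideanSpace.single i 1) * g x :=
    ((((hFi i).continuous_fderiv one_ne_zero).clm_apply continuous_const).mul
      hg.continuous).integrable_of_hasCompactSupport hgc.mul_left
  simp_rw [hl, divg, Finset.sum_mul, ← hfd]
  rw [integral_finsetSum _ fun i _ => h1 i, integral_finsetSum _ fun i _ => h2 i,
    ← Finset.sum_neg_distrib]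
  refine Finset.sum_congr rfl fun i _ => ?_
  exact integral_mul_fderiv_eq_neg_fderiv_mul_of_integrable (h2 i) (h1 i)
    (((hFi i).continuous.mul hg.continuous).integrable_of_hasCompactSupport hgc.mul_left)
    (fun x _ => (hFi i).differentiable one_ne_zero x)
    (fun x _ => hg.differentiable one_ne_zero x)

end Divergence

/-- **Time derivative of the relative energy for the nonlocal Allen–Cahn equation.**
If `u` solves `∂ₜu = Δu - ε⁻²W'(u) + λ_ε(t)√(2W(u))` on `ℝ^d × [0,T]`,
`ξ ∈ C¹(ℝ^d × [0,T];ℝ^d)` is bounded with bounded derivatives, and `λ : [0,T] → ℝ` is any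
function, then the relative energy
`E(t) = ∫ ((ε/2)|∇u|² + ε⁻¹W(u)) dx + ∫ ξ·∇ψ dx` satisfies, for every `t ∈ (0,T)`,
`d/dt E(t) = -∫ ε (∂ₜu)² dx - ∫ (∇·ξ - λ(t)) √(2W(u)) ∂ₜu dx + ∫ ∂ₜξ·∇ψ dx`,
where `∇ψ = √(2W(u))∇u`. -/
theorem relative_energy_derivative_nonlocal_allen_cahn
    (d : ℕ) (hd : 1 ≤ d) (ε T : ℝ) (hε : 0 < ε) (hT : 0 < T)
    (W : ℝ → ℝ) (hW : ContDiff ℝ 1 W) (hWnonneg : ∀ z, 0 ≤ W z) (hW0 : W 0 = 0)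
    (u ut : ℝ → EuclideanSpace ℝ (Fin d) → ℝ)
    (gut : ℝ → EuclideanSpace ℝ (Fin d) → EuclideanSpace ℝ (Fin d))
    -- `u(·,t)` is C² in space
    (hu_space : ∀ t ∈ Set.Icc (0:ℝ) T, ContDiff ℝ 2 (u t))
    -- `u(x,·)` is C¹ in time, with time derivative `ut`
    (hu_time : ∀ x, ∀ t ∈ Set.Icc (0:ℝ) T,
      HasDerivWithinAt (fun s => u s x) (ut t x) (Set.Icc 0 T) t)
    (hut_cont : ContinuousOn (fun p : ℝ × EuclideanSpace ℝ (Fin d) => ut p.1 p.2)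
      (Set.Icc 0 T ×ˢ Set.univ))
    -- `∇u(x,·)` is also C¹ in time, with time derivative `gut`
    (hgu_time : ∀ x, ∀ t ∈ Set.Icc (0:ℝ) T,
      HasDerivWithinAt (fun s => gradient (u s) x) (gut t x) (Set.Icc 0 T) t)
    (hgut_cont : ContinuousOn (fun p : ℝ × EuclideanSpace ℝ (Fin d) => gut p.1 p.2)
      (Set.Icc 0 T ×ˢ Set.univ))
    -- uniform compact support
    (K : Set (EuclideanSpace ℝ (Fin d))) (hK : IsCompact K)
    (hsupp : ∀ t ∈ Set.Icc (0:ℝ) T, ∀ x ∉ K, u t x = 0)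
    -- nondegeneracy
    (hpos : ∀ t ∈ Set.Icc (0:ℝ) T, 0 < ∫ x, 2 * W (u t x))
    -- the Lagrange multiplier
    (lamEps : ℝ → ℝ)
    (hlamEps : ∀ t ∈ Set.Icc (0:ℝ) T, lamEps t =
      -(∫ x, (lap (u t) x - (ε^2)⁻¹ * deriv W (u t x)) * Real.sqrt (2 * W (u t x))) /
        (∫ x, 2 * W (u t x)))
    -- the nonlocal Allen–Cahn equation
    (hPDE : ∀ t ∈ Set.Icc (0:ℝ) T, ∀ x, ut t x =
      lap (u t) x - (ε^2)⁻¹ * deriv W (u t x) + lamEps t * Real.sqrt (2 * W (u t x)))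
    -- the vector field `ξ`, C¹ in space and time, bounded with bounded derivatives
    (ξ ξt : ℝ → EuclideanSpace ℝ (Fin d) → EuclideanSpace ℝ (Fin d))
    (hξ_space : ∀ t ∈ Set.Icc (0:ℝ) T, ContDiff ℝ 1 (ξ t))
    (hξ_time : ∀ x, ∀ t ∈ Set.Icc (0:ℝ) T,
      HasDerivWithinAt (fun s => ξ s x) (ξt t x) (Set.Icc 0 T) t)
    (hξt_cont : ContinuousOn (fun p : ℝ × EuclideanSpace ℝ (Fin d) => ξt p.1 p.2)
      (Set.Icc 0 T ×ˢ Set.univ))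
    (hξ_bdd : ∃ C : ℝ, ∀ t ∈ Set.Icc (0:ℝ) T, ∀ x,
      ‖ξ t x‖ ≤ C ∧ ‖fderiv ℝ (ξ t) x‖ ≤ C ∧ ‖ξt t x‖ ≤ C)
    -- `λ : [0,T] → ℝ` is any function
    (lam : ℝ → ℝ) :
    ∀ t ∈ Set.Ioo (0:ℝ) T,
      HasDerivAt
        (fun s => (∫ x, (ε/2 * ‖gradient (u s) x‖^2 + ε⁻¹ * W (u s x)))
          + ∫ x, ⟪ξ s x, Real.sqrt (2 * W (u s x)) • gradient (u s) x⟫)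
        (-(∫ x, ε * (ut t x)^2)
          - (∫ x, (divg (ξ t) x - lam t) * Real.sqrt (2 * W (u t x)) * ut t x)
          + ∫ x, ⟪ξt t x, Real.sqrt (2 * W (u t x)) • gradient (u t) x⟫) t := by
  intro t ht
  have htI : t ∈ Set.Icc (0:ℝ) T := Set.Ioo_subset_Icc_self ht
  have hnhds : Set.Icc (0:ℝ) T ∈ 𝓝 t := Icc_mem_nhds ht.1 ht.2
  have slice {Y : Type} [TopologicalSpace Y] {f : ℝ → EuclideanSpace ℝ (Fin d) → Y}
      (hf : ContinuousOn (fun p : ℝ × EuclideanSpace ℝ (Fin d) => f p.1 p.2)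
        (Set.Icc 0 T ×ˢ Set.univ)) : Continuous (f t) :=
    hf.comp_continuous (f := fun x => (t, x)) (by fun_prop) fun x => ⟨htI, trivial⟩
  have hgrad (s) (hs : s ∈ Set.Icc (0:ℝ) T) : ContDiff ℝ 1 (gradient (u s)) :=
    (hu_space s hs).gradient_right (by norm_num [one_add_one_eq_two])
  have hgrad0 (s) (hs : s ∈ Set.Icc (0:ℝ) T) (x) (hx : x ∉ K) : gradient (u s) x = 0 :=
    gradient_eq_zero_off_closed hK.isClosed (hsupp s hs) hx
  have hu_cont := continuousOn_prod_of_continuousOn_deriv hu_time hut_cont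
    fun s hs => (hu_space s hs).continuous
  have hgu_cont := continuousOn_prod_of_continuousOn_deriv hgu_time hgut_cont
    fun s hs => (hgrad s hs).continuous
  have hut0 (x) (hx : x ∉ K) : ut t x = 0 := by
    refine ((hu_time x t htI).hasDerivAt hnhds).unique
      ((hasDerivAt_const t (0:ℝ)).congr_of_eventuallyEq ?_)
    filter_upwards [hnhds] with s hs using hsupp s hs x hx
  have hutc := slice hut_cont
  have huc := slice hu_cont
  have hWc := hW.continuous
  have hdWc : Continuous (deriv W) := hW.continuous_deriv le_rfl
  have hWd (z) : HasDerivAt W (deriv W z) z := (hW.differentiable one_ne_zero z).hasDerivAt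
  have hsq : Continuous fun z => √(2 * W z) := by fun_prop
  have hlapc : Continuous (lap (u t)) := (hgrad t htI).continuous_divg
  have hdivc : Continuous (divg (ξ t)) := (hξ_space t htI).continuous_divg
  -- the primitive `φ` of `√(2W)`
  obtain ⟨φ, hφ, hφ0⟩ : ∃ φ : ℝ → ℝ, (∀ r, HasDerivAt φ (√(2 * W r)) r) ∧ φ 0 = 0 :=
    ⟨fun r => ∫ z in (0:ℝ)..r, √(2 * W z), fun r => intervalIntegral.integral_hasDerivAt_right
      (hsq.intervalIntegrable _ _) (hsq.stronglyMeasurableAtFilter _ _) hsq.continuousAt, by simp⟩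
  have hφC : ContDiff ℝ 1 φ := by
    rw [contDiff_one_iff_deriv]
    refine ⟨fun r => (hφ r).differentiableAt, ?_⟩
    rwa [show deriv φ = fun r => √(2 * W r) from funext fun r => (hφ r).deriv]
  have hψ (s) (hs : s ∈ Set.Icc (0:ℝ) T) (x) :
      gradient (fun y => φ (u s y)) x = √(2 * W (u s x)) • gradient (u s) x :=
    gradient_comp (hφ _) ((hu_space s hs).differentiable two_ne_zero x)
  -- the Dirichlet and potential energies
  have hE : HasDerivAt (fun s => ∫ x, (ε/2 * ‖gradient (u s) x‖^2 + ε⁻¹ * W (u s x)))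
      (∫ x, (ε * ⟪gradient (u t) x, gut t x⟫ + ε⁻¹ * (deriv W (u t x) * ut t x))) t := by
    refine hasDerivAt_integral_of_compact_of_continuousOn_deriv hK ht
      (F' := fun t x => ε * ⟪gradient (u t) x, gut t x⟫ + ε⁻¹ * (deriv W (u t x) * ut t x))
      (fun s hs => ?_) (fun s hs x hx => ?_) (fun x s hs => ?_) ?_
    · have h1 := (hgrad s hs).continuous
      have h2 := (hu_space s hs).continuous
      fun_prop
    · simp [hgrad0 s hs x hx, hsupp s hs x hx, hW0]
    · refine (((hgu_time x s hs).norm_sq.const_mul (ε/2)).add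
        (((hWd (u s x)).comp_hasDerivWithinAt s (hu_time x s hs)).const_mul ε⁻¹)).congr_deriv ?_
      ring
    · have := hdWc.comp_continuousOn hu_cont
      fun_prop
  -- weak form of `gut = ∇ut`, tested against `∇u`
  have hmixed : ∫ x, ⟪gradient (u t) x, gut t x⟫ = -∫ x, lap (u t) x * ut t x := by
    have h1 : HasDerivAt (fun s => ∫ x, ⟪gradient (u t) x, gradient (u s) x⟫)
        (∫ x, ⟪gradient (u t) x, gut t x⟫) t := by
      have h0 := (hgrad t htI).continuous
      refine hasDerivAt_integral_of_compact_of_continuousOn_deriv hK ht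
        (F' := fun s x => ⟪gradient (u t) x, gut s x⟫)
        (fun s hs => h0.inner (hgrad s hs).continuous)
        (fun s hs x hx => by simp [hgrad0 s hs x hx]) (fun x s hs => ?_) ?_
      · simpa using (hasDerivWithinAt_const s (Set.Icc 0 T) (gradient (u t) x)).inner ℝ
          (hgu_time x s hs)
      · exact (h0.comp continuous_snd).continuousOn.inner hgut_cont
    have h2 : HasDerivAt (fun s => ∫ x, lap (u t) x * u s x) (∫ x, lap (u t) x * ut t x) t :=
      hasDerivAt_integral_of_compact_of_continuousOn_deriv hK ht
        (F' := fun s x => lap (u t) x * ut s x)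
        (fun s hs => hlapc.mul (hu_space s hs).continuous)
        (fun s hs x hx => by simp [hsupp s hs x hx])
        (fun x s hs => (hu_time x s hs).const_mul _)
        ((hlapc.comp continuous_snd).continuousOn.mul hut_cont)
    refine h1.unique (h2.neg.congr_of_eventuallyEq ?_)
    filter_upwards [hnhds] with s hs
    exact integral_inner_gradient_eq_neg_integral_divg_mul (hgrad t htI)
      ((hu_space s hs).of_le one_le_two) (HasCompactSupport.intro hK (hsupp s hs))
  -- the calibration term, with `ξ` frozen at time `t`
  have hfrozen : HasDerivAt (fun s => ∫ x, divg (ξ t) x * φ (u s x))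
      (∫ x, divg (ξ t) x * (√(2 * W (u t x)) * ut t x)) t := by
    refine hasDerivAt_integral_of_compact_of_continuousOn_deriv hK ht
      (F' := fun s x => divg (ξ t) x * (√(2 * W (u s x)) * ut s x))
      (fun s hs => hdivc.mul (hφC.continuous.comp (hu_space s hs).continuous))
      (fun s hs x hx => by simp [hsupp s hs x hx, hφ0])
      (fun x s hs => ((hφ _).comp_hasDerivWithinAt s (hu_time x s hs)).const_mul _) ?_
    exact (hdivc.comp continuous_snd).continuousOn.mul
      ((hsq.comp_continuousOn hu_cont).mul hut_cont)
  -- the remaining variation of `ξ`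
  have hvar : HasDerivAt
      (fun s => ∫ x, ⟪ξ s x - ξ t x, √(2 * W (u s x)) • gradient (u s) x⟫)
      (∫ x, ⟪ξt t x, √(2 * W (u t x)) • gradient (u t) x⟫) t := by
    have hgψ := (hsq.comp_continuousOn hu_cont).smul hgu_cont
    obtain ⟨M, hM⟩ := (isCompact_Icc.prod hK).exists_bound_of_continuousOn
      (hgψ.mono (Set.prod_mono subset_rfl (Set.subset_univ K)))
    obtain ⟨C, hC⟩ := exists_lipschitz_of_continuousOn_deriv hK hξ_time hξt_cont
    refine hasDerivAt_integral_of_compact_of_lip hK hnhds (C := C * M.toNNReal)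
      (fun s hs => ?_) (fun s hs x hx => by simp [hgrad0 s hs x hx])
      ((slice hξt_cont).inner ((hsq.comp huc).smul (hgrad t htI).continuous))
      (fun x hx s hs => ?_) (fun x => ?_)
    · exact ((hξ_space s hs).continuous.sub (hξ_space t htI).continuous).inner
        ((hsq.comp (hu_space s hs).continuous).smul (hgrad s hs).continuous)
    · rw [sub_self, inner_zero_left, sub_zero, NNReal.coe_mul, mul_right_comm]
      exact (norm_inner_le_norm _ _).trans (mul_le_mul (hC x hx s hs t htI)
        ((hM (s, x) ⟨hs, hx⟩).trans (Real.le_coe_toNNReal M)) (norm_nonneg _) (by positivity))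
    · refine HasDerivAt.inner_of_eq_zero
        (((hξ_time x t htI).hasDerivAt hnhds).sub_const (ξ t x)) ?_ (sub_self _)
      exact (hsq.continuousAt.comp ((hu_time x t htI).hasDerivAt hnhds).continuousAt).smul
        ((hgu_time x t htI).hasDerivAt hnhds).continuousAt
  have hC : HasDerivAt (fun s => ∫ x, ⟪ξ s x, √(2 * W (u s x)) • gradient (u s) x⟫)
      ((∫ x, ⟪ξt t x, √(2 * W (u t x)) • gradient (u t) x⟫)
        - ∫ x, divg (ξ t) x * (√(2 * W (u t x)) * ut t x)) t := by
    refine (hvar.sub hfrozen).congr_of_eventuallyEq ?_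
    filter_upwards [hnhds] with s hs
    have hibp := integral_inner_gradient_eq_neg_integral_divg_mul (hξ_space t htI)
      (hφC.comp ((hu_space s hs).of_le one_le_two))
      (HasCompactSupport.intro hK fun x hx => by simp [hsupp s hs x hx, hφ0])
    have hint (η : EuclideanSpace ℝ (Fin d) → EuclideanSpace ℝ (Fin d)) (hη : Continuous η) :
        Integrable fun x => ⟪η x, √(2 * W (u s x)) • gradient (u s) x⟫ :=
      (hη.inner ((hsq.comp (hu_space s hs).continuous).smul
        (hgrad s hs).continuous)).integrable_of_eq_zero_off_compact hK
        fun x hx => by simp [hgrad0 s hs x hx]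
    simp only [Function.comp_def, hψ s hs] at hibp
    simp only [Pi.sub_apply, inner_sub_left]
    rw [integral_sub (hint _ (hξ_space s hs).continuous) (hint _ (hξ_space t htI).continuous), hibp]
    ring
  -- volume conservation
  have hsqc : Continuous fun x => √(2 * W (u t x)) := hsq.comp huc
  have hint0 (f : EuclideanSpace ℝ (Fin d) → ℝ) (hf : Continuous f) :
      Integrable fun x => f x * √(2 * W (u t x)) :=
    (hf.mul hsqc).integrable_of_eq_zero_off_compact hK
      fun x hx => by simp [hsupp t htI x hx, hW0]
  have hintut (f : EuclideanSpace ℝ (Fin d) → ℝ) (hf : Continuous f) :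
      Integrable fun x => f x * ut t x :=
    (hf.mul hutc).integrable_of_eq_zero_off_compact hK fun x hx => by simp [hut0 x hx]
  have hvol : ∫ x, √(2 * W (u t x)) * ut t x = 0 := by
    have hpt (x) : √(2 * W (u t x)) * ut t x =
        (lap (u t) x - (ε^2)⁻¹ * deriv W (u t x)) * √(2 * W (u t x))
          + lamEps t * (2 * W (u t x)) := by
      rw [hPDE t htI x]
      linear_combination lamEps t *
        Real.mul_self_sqrt (mul_nonneg zero_le_two (hWnonneg (u t x)))
    have hi : Integrable fun x => lamEps t * (2 * W (u t x)) :=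
      Continuous.integrable_of_eq_zero_off_compact (by fun_prop) hK
        fun x hx => by simp [hsupp t htI x hx, hW0]
    simp_rw [hpt]
    rw [integral_add (hint0 _ (by fun_prop)) hi, integral_const_mul, hlamEps t htI,
      div_mul_cancel₀ _ (hpos t htI).ne', add_neg_cancel]
  have hgi : Integrable fun x => ⟪gradient (u t) x, gut t x⟫ :=
    ((hgrad t htI).continuous.inner (slice hgut_cont)).integrable_of_eq_zero_off_compact hK
      fun x hx => by simp [hgrad0 t htI x hx]
  refine (hE.add hC).congr_deriv ?_
  have hE' : ∫ x, (ε * ⟪gradient (u t) x, gut t x⟫ + ε⁻¹ * (deriv W (u t x) * ut t x))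
      = -∫ x, ε * (ut t x)^2 := by
    have hpt (x) : ε * (ut t x)^2 = ε * (lap (u t) x * ut t x)
        + (-ε⁻¹ * (deriv W (u t x) * ut t x)
        + ε * lamEps t * (√(2 * W (u t x)) * ut t x)) := by
      have hεinv : ε * (ε^2)⁻¹ = ε⁻¹ := by field_simp
      linear_combination ε * ut t x * hPDE t htI x - deriv W (u t x) * ut t x * hεinv
    have i1 := (hintut _ hlapc).const_mul ε
    have i2 := hintut (fun x => deriv W (u t x)) (hdWc.comp huc)
    have i3 := (hintut _ hsqc).const_mul (ε * lamEps t)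
    simp_rw [hpt]
    rw [integral_add (hgi.const_mul ε) (i2.const_mul ε⁻¹),
      integral_add i1 ((i2.const_mul (-ε⁻¹)).fun_add i3), integral_add (i2.const_mul (-ε⁻¹)) i3]
    simp only [integral_const_mul, hvol, hmixed]
    ring
  have hlam : ∫ x, (divg (ξ t) x - lam t) * √(2 * W (u t x)) * ut t x
      = ∫ x, divg (ξ t) x * (√(2 * W (u t x)) * ut t x) := by
    have i1 := hintut _ (hdivc.mul hsqc)
    have i2 := (hintut _ hsqc).const_mul (lam t)
    simp only [Pi.mul_apply, mul_assoc] at i1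
    simp_rw [sub_mul, mul_assoc]
    rw [integral_sub i1 i2, integral_const_mul, hvol, mul_zero, sub_zero]
  rw [hE', hlam]
  ring
end

section
/- The relative energy controls the tilt-excess with density ε|∇u|²: ∫_{ℝ^d} |ν_ε(x) − ξ(x)|² ε |∇u(x)|² dx ≤ 12 E_rel[u,ξ]. -/
open MeasureTheory
open scoped RealInnerProductSpace Classical

/-- `∇ψ = √(2W(u)) ∇u`, the gradient of the Modica–Mortola transform `ψ = φ ∘ u`. -/
noncomputable def gradPsi {d : ℕ} (W : ℝ → ℝ) (u : EuclideanSpace ℝ (Fin d) → ℝ)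
    (x : EuclideanSpace ℝ (Fin d)) : EuclideanSpace ℝ (Fin d) :=
  Real.sqrt (2 * W (u x)) • gradient u x

/-- The approximate unit normal `ν_ε = -∇u/|∇u|` (with value `e` where `∇u = 0`). -/
noncomputable def nuEps {d : ℕ} (u : EuclideanSpace ℝ (Fin d) → ℝ)
    (e : EuclideanSpace ℝ (Fin d)) (x : EuclideanSpace ℝ (Fin d)) : EuclideanSpace ℝ (Fin d) :=
  if gradient u x = 0 then e else -(‖gradient u x‖⁻¹ • gradient u x)

/-- The Cahn–Hilliard energy `E_ε[u] = ∫ ((ε/2)|∇u|² + ε⁻¹ W(u)) dx`. -/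
noncomputable def cahnHilliardEnergy {d : ℕ} (ε : ℝ) (W : ℝ → ℝ)
    (u : EuclideanSpace ℝ (Fin d) → ℝ) : ℝ :=
  ∫ x, (ε/2 * ‖gradient u x‖^2 + ε⁻¹ * W (u x))

/-- The relative energy `E_rel[u,ξ] = E_ε[u] + ∫ ξ·∇ψ dx`. -/
noncomputable def relEnergy {d : ℕ} (ε : ℝ) (W : ℝ → ℝ)
    (u : EuclideanSpace ℝ (Fin d) → ℝ)
    (ξ : EuclideanSpace ℝ (Fin d) → EuclideanSpace ℝ (Fin d)) : ℝ :=
  cahnHilliardEnergy ε W u + ∫ x, ⟪ξ x, gradPsi W u x⟫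

section TiltExcess

variable {d : ℕ}

lemma norm_nuEps (u : EuclideanSpace ℝ (Fin d) → ℝ) {e : EuclideanSpace ℝ (Fin d)}
    (he : ‖e‖ = 1) (x : EuclideanSpace ℝ (Fin d)) : ‖nuEps u e x‖ = 1 := by
  unfold nuEps
  split_ifs with h
  · exact he
  · rw [norm_neg, norm_smul, norm_inv, norm_norm, inv_mul_cancel₀ (norm_ne_zero_iff.mpr h)]

lemma gradient_eq_neg_norm_smul_nuEps (u : EuclideanSpace ℝ (Fin d) → ℝ)
    (e x : EuclideanSpace ℝ (Fin d)) :
    gradient u x = -(‖gradient u x‖ • nuEps u e x) := by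
  unfold nuEps
  split_ifs with h
  · simp [h]
  · rw [smul_neg, neg_neg, smul_smul, mul_inv_cancel₀ (norm_ne_zero_iff.mpr h), one_smul]

/-- The difference of the two sides is affine in `t` and nonnegative at `t = -1` and `t = 1`. -/
lemma tilt_mul_le_relative_density {ε g s w t : ℝ} (hε : 0 < ε) (hg : 0 ≤ g) (hs : 0 ≤ s)
    (hw : s ^ 2 = 2 * w) (ht₁ : -1 ≤ t) (ht₂ : t ≤ 1) :
    (2 - 2 * t) * (ε * g ^ 2) ≤ 12 * (ε / 2 * g ^ 2 + ε⁻¹ * w - t * (s * g)) := by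
  have hw' : w = s ^ 2 / 2 := by linarith
  have key : 12 * (ε / 2 * g ^ 2 + ε⁻¹ * w - t * (s * g)) - (2 - 2 * t) * (ε * g ^ 2)
      = ε⁻¹ * ((1 - t) * ((ε * g) ^ 2 + 3 * s ^ 2 + 6 * (ε * g * s))
        + (1 + t) * (3 * (ε * g - s) ^ 2)) := by
    rw [hw']
    field_simp
    ring
  have h₁ : 0 ≤ 1 - t := by linarith
  have h₂ : 0 ≤ 1 + t := by linarith
  have : 0 ≤ ε⁻¹ * ((1 - t) * ((ε * g) ^ 2 + 3 * s ^ 2 + 6 * (ε * g * s))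
        + (1 + t) * (3 * (ε * g - s) ^ 2)) := by positivity
  linarith

lemma tilt_excess_density_le {ε : ℝ} (hε : 0 < ε) {W : ℝ → ℝ} (hW : ∀ z, 0 ≤ W z)
    (u : EuclideanSpace ℝ (Fin d) → ℝ) {e : EuclideanSpace ℝ (Fin d)} (he : ‖e‖ = 1)
    {v : EuclideanSpace ℝ (Fin d)} (hv : ‖v‖ ≤ 1) (x : EuclideanSpace ℝ (Fin d)) :
    ‖nuEps u e x - v‖ ^ 2 * (ε * ‖gradient u x‖ ^ 2)
      ≤ 12 * (ε / 2 * ‖gradient u x‖ ^ 2 + ε⁻¹ * W (u x) + ⟪v, gradPsi W u x⟫) := by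
  have hν := norm_nuEps u he x
  have ht : |⟪nuEps u e x, v⟫| ≤ 1 := by
    simpa [hν] using (abs_real_inner_le_norm (nuEps u e x) v).trans
      (mul_le_mul_of_nonneg_left hv (norm_nonneg _))
  have hnorm : ‖nuEps u e x - v‖ ^ 2 ≤ 2 - 2 * ⟪nuEps u e x, v⟫ := by
    rw [norm_sub_sq_real, hν]
    nlinarith [norm_nonneg v]
  have hinner : ⟪v, gradPsi W u x⟫
      = -(⟪nuEps u e x, v⟫ * (√(2 * W (u x)) * ‖gradient u x‖)) := by
    have h : ⟪v, gradient u x⟫ = -(‖gradient u x‖ * ⟪nuEps u e x, v⟫) := by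
      conv_lhs => rw [gradient_eq_neg_norm_smul_nuEps u e x]
      rw [inner_neg_right, real_inner_smul_right, real_inner_comm]
    rw [gradPsi, real_inner_smul_right, h]
    ring
  rw [hinner, ← sub_eq_add_neg]
  refine (mul_le_mul_of_nonneg_right hnorm (by positivity)).trans ?_
  exact tilt_mul_le_relative_density hε (norm_nonneg _) (Real.sqrt_nonneg _)
    (Real.sq_sqrt (mul_nonneg zero_le_two (hW _))) (abs_le.mp ht).1 (abs_le.mp ht).2

end TiltExcess

/-- **The relative energy controls the tilt-excess with density `ε|∇u|²`:**
`∫ |ν_ε - ξ|² ε|∇u|² dx ≤ 12 E_rel[u,ξ]`. -/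
theorem relEnergy_controls_tilt_excess_gradu
    (d : ℕ) (hd : 1 ≤ d) (ε : ℝ) (hε : 0 < ε)
    (W : ℝ → ℝ) (hWc : Continuous W) (hWnonneg : ∀ z, 0 ≤ W z)
    (u : EuclideanSpace ℝ (Fin d) → ℝ) (hu : ContDiff ℝ 1 u)
    (hE : Integrable (fun x => ε/2 * ‖gradient u x‖^2 + ε⁻¹ * W (u x)))
    (hgradPsi : Integrable (gradPsi W u))
    (e : EuclideanSpace ℝ (Fin d)) (he : ‖e‖ = 1)
    (ξ : EuclideanSpace ℝ (Fin d) → EuclideanSpace ℝ (Fin d))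
    (hξmeas : Measurable ξ) (hξ1 : ∀ x, ‖ξ x‖ ≤ 1) :
    (∫ x, ‖nuEps u e x - ξ x‖^2 * (ε * ‖gradient u x‖^2)) ≤ 12 * relEnergy ε W u ξ := by
  have hinner : Integrable (fun x => ⟪ξ x, gradPsi W u x⟫) := by
    refine hgradPsi.mono (hξmeas.aestronglyMeasurable.inner hgradPsi.aestronglyMeasurable)
      (.of_forall fun x => (norm_inner_le_norm _ _).trans ?_)
    exact mul_le_of_le_one_left (norm_nonneg _) (hξ1 x)
  rw [relEnergy, cahnHilliardEnergy, ← integral_add hE hinner, ← integral_const_mul]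
  exact integral_mono_of_nonneg (.of_forall fun x => by positivity)
    ((hE.add hinner).const_mul 12)
    (.of_forall fun x => tilt_excess_density_le hε hWnonneg u he (hξ1 x) x)
end

section
/- Suppose in addition that Σ ⊂ ℝ^d is a nonempty closed set, c₀ > 0, and the vector field ξ satisfies the shortness condition |ξ(x)| ≤ max(1 − c₀ dist(x,Σ)², 0) for all x ∈ ℝ^d. Then the relative energy controls the energy density away from Σ: ∫_{ℝ^d} min{ dist(x,Σ)², c₀⁻¹ } ( (ε/2)|∇u(x)|² + ε⁻¹W(u(x)) ) dx ≤ c₀⁻¹ E_rel[u,ξ]. -/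
open MeasureTheory
open scoped RealInnerProductSpace Classical

/-- The Modica–Mortola inequality `|∇ψ| ≤ (ε/2)|∇u|² + ε⁻¹ W(u)`. -/
theorem norm_gradPsi_le_energyDensity {d : ℕ} {ε : ℝ} (hε : 0 < ε) {W : ℝ → ℝ}
    (hW : ∀ z, 0 ≤ W z) (u : EuclideanSpace ℝ (Fin d) → ℝ) (x : EuclideanSpace ℝ (Fin d)) :
    ‖gradPsi W u x‖ ≤ ε/2 * ‖gradient u x‖^2 + ε⁻¹ * W (u x) := by
  rw [gradPsi, norm_smul, Real.norm_of_nonneg (Real.sqrt_nonneg _)]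
  have hs : Real.sqrt (2 * W (u x)) ^ 2 = 2 * W (u x) :=
    Real.sq_sqrt (mul_nonneg zero_le_two (hW _))
  have hsq : ε/2 * ‖gradient u x‖^2 + ε⁻¹ * W (u x) - Real.sqrt (2 * W (u x)) * ‖gradient u x‖
      = (2 * ε)⁻¹ * (ε * ‖gradient u x‖ - Real.sqrt (2 * W (u x))) ^ 2 := by
    field_simp
    linear_combination -hs
  have : 0 ≤ (2 * ε)⁻¹ * (ε * ‖gradient u x‖ - Real.sqrt (2 * W (u x))) ^ 2 := by positivity
  linarith

/-- **The relative energy controls the energy density away from `Σ`:**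
if `|ξ(x)| ≤ max(1 - c₀ dist(x,Σ)², 0)`, then
`∫ min(dist(x,Σ)², c₀⁻¹) ((ε/2)|∇u|² + ε⁻¹W(u)) dx ≤ c₀⁻¹ E_rel[u,ξ]`. -/
theorem relEnergy_controls_energy_away_from_interface
    (d : ℕ) (hd : 1 ≤ d) (ε : ℝ) (hε : 0 < ε)
    (W : ℝ → ℝ) (hWc : Continuous W) (hWnonneg : ∀ z, 0 ≤ W z)
    (u : EuclideanSpace ℝ (Fin d) → ℝ) (hu : ContDiff ℝ 1 u)
    (hE : Integrable (fun x => ε/2 * ‖gradient u x‖^2 + ε⁻¹ * W (u x)))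
    (hgradPsi : Integrable (gradPsi W u))
    (ξ : EuclideanSpace ℝ (Fin d) → EuclideanSpace ℝ (Fin d)) (hξmeas : Measurable ξ)
    (Sigma0 : Set (EuclideanSpace ℝ (Fin d))) (hSne : Sigma0.Nonempty) (hScl : IsClosed Sigma0)
    (c₀ : ℝ) (hc₀ : 0 < c₀)
    (hξshort : ∀ x, ‖ξ x‖ ≤ max (1 - c₀ * (Metric.infDist x Sigma0)^2) 0) :
    (∫ x, min ((Metric.infDist x Sigma0)^2) c₀⁻¹
        * (ε/2 * ‖gradient u x‖^2 + ε⁻¹ * W (u x)))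
      ≤ c₀⁻¹ * relEnergy ε W u ξ := by
  have hdens : ∀ x, 0 ≤ ε/2 * ‖gradient u x‖^2 + ε⁻¹ * W (u x) := fun x =>
    (norm_nonneg _).trans (norm_gradPsi_le_energyDensity hε hWnonneg u x)
  have hξ_le_one : ∀ x, ‖ξ x‖ ≤ 1 := fun x =>
    (hξshort x).trans (max_le (sub_le_self _ (by positivity)) zero_le_one)
  have hinner : Integrable (fun x => ⟪ξ x, gradPsi W u x⟫) := by
    refine hgradPsi.norm.mono' (hξmeas.aestronglyMeasurable.inner hgradPsi.1)
      (Filter.Eventually.of_forall fun x => (norm_inner_le_norm _ _).trans ?_)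
    exact mul_le_of_le_one_left (norm_nonneg _) (hξ_le_one x)
  rw [relEnergy, cahnHilliardEnergy, ← integral_add hE hinner, ← integral_const_mul]
  refine integral_mono_of_nonneg
    (Filter.Eventually.of_forall fun x => mul_nonneg (by positivity) (hdens x))
    ((hE.add hinner).const_mul _) (Filter.Eventually.of_forall fun x => ?_)
  have hmin : min ((Metric.infDist x Sigma0)^2) c₀⁻¹ ≤ c₀⁻¹ * (1 - ‖ξ x‖) := by
    rw [le_inv_mul_iff₀ hc₀, mul_min_of_nonneg _ _ hc₀.le, mul_inv_cancel₀ hc₀.ne']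
    rcases le_max_iff.1 (hξshort x) with h | h
    · exact (min_le_left _ _).trans (by linarith)
    · exact (min_le_right _ _).trans (by linarith)
  have hlower : -(‖ξ x‖ * (ε/2 * ‖gradient u x‖^2 + ε⁻¹ * W (u x))) ≤ ⟪ξ x, gradPsi W u x⟫ :=
    (neg_le_neg (mul_le_mul_of_nonneg_left
      (norm_gradPsi_le_energyDensity hε hWnonneg u x) (norm_nonneg _))).trans
      (neg_le_of_abs_le (abs_real_inner_le_norm _ _))
  calc min ((Metric.infDist x Sigma0)^2) c₀⁻¹ * (ε/2 * ‖gradient u x‖^2 + ε⁻¹ * W (u x))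
      ≤ c₀⁻¹ * (1 - ‖ξ x‖) * (ε/2 * ‖gradient u x‖^2 + ε⁻¹ * W (u x)) :=
        mul_le_mul_of_nonneg_right hmin (hdens x)
    _ = c₀⁻¹ * ((ε/2 * ‖gradient u x‖^2 + ε⁻¹ * W (u x))
          + -(‖ξ x‖ * (ε/2 * ‖gradient u x‖^2 + ε⁻¹ * W (u x)))) := by ring
    _ ≤ c₀⁻¹ * ((ε/2 * ‖gradient u x‖^2 + ε⁻¹ * W (u x)) + ⟪ξ x, gradPsi W u x⟫) := by
        gcongr
end
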